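/- Let T ≥ 5 and X ≥ 3, and let k be a positive integer with X^k ≤ T. Then for any complex numbers a(p) indexed by primes p, ∫_T^{2T} | ∑_{p ≤ X, p prime} a(p)·p^{−it} |^{2k} dt ≪ T·k!·( ∑_{p ≤ X, p prime} |a(p)|² )^k, with an absolute implied constant. -/

import Mathlib

open Complex MeasureTheory Finset ProbabilityTheory
open scoped Classical

noncomputable section

/-- The smoothing weight `w_X(y)`. -/
def wX (X y : ℝ) : ℝ :=
  if y < 1 then 0
  else if y ≤ X ^ ((1:ℝ)/3) then 1
  else if y ≤ X ^ ((2:ℝ)/3) then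
    (9 * (Real.log (X / y))^2 - 6 * (Real.log (X ^ ((2:ℝ)/3) / y))^2) /
      (2 * (Real.log (X ^ ((2:ℝ)/3)))^2)
  else if y ≤ X then 9 * (Real.log (X / y))^2 / (2 * (Real.log X)^2)
  else 0

/-- The finite set of primes `p ≤ X`. -/
def primesUpTo (X : ℝ) : Finset ℕ := (Finset.range (⌊X⌋₊ + 1)).filter Nat.Prime

end

/-- Gaussian decay of the Fourier transform of a Gaussian, at a difference of logarithms. -/
theorem gaussian_log_sub_le {T : ℝ} {m n : ℕ} (hm : 0 < m) (hn : 0 < n)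
    (hmT : (m : ℝ) ≤ T) (hnT : (n : ℝ) ≤ T) :
    Real.exp (-(T ^ 2 * (Real.log m - Real.log n) ^ 2 / 4)) ≤
      Real.exp (-(((m : ℤ) - n : ℤ) : ℝ) ^ 2 / 4) := by
  wlog hmn : n ≤ m generalizing m n
  · have := this hn hm hnT hmT (by omega)
    push_cast at this ⊢
    rwa [sub_sq_comm (Real.log n), sub_sq_comm (n : ℝ)] at this
  have hm' : (0 : ℝ) < m := by exact_mod_cast hm
  have hn' : (0 : ℝ) < n := by exact_mod_cast hn
  have hmn' : (n : ℝ) ≤ m := by exact_mod_cast hmn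
  have hlog : ((m : ℝ) - n) / m ≤ Real.log m - Real.log n := by
    have h := Real.one_sub_inv_le_log_of_pos (div_pos hm' hn')
    rw [Real.log_div hm'.ne' hn'.ne', inv_div] at h
    rwa [sub_div, div_self hm'.ne']
  have h : (m : ℝ) - n ≤ T * (Real.log m - Real.log n) := by
    rw [div_le_iff₀ hm'] at hlog
    have h0 : 0 ≤ Real.log m - Real.log n := sub_nonneg.2 (Real.log_le_log hn' hmn')
    nlinarith
  have h2 : ((m : ℝ) - n) ^ 2 ≤ (T * (Real.log m - Real.log n)) ^ 2 :=
    pow_le_pow_left₀ (sub_nonneg.2 hmn') h 2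
  apply Real.exp_le_exp.2
  push_cast
  nlinarith

theorem summable_exp_neg_int_sq_div_four :
    Summable fun d : ℤ ↦ Real.exp (-(d : ℝ) ^ 2 / 4) := by
  have h : Summable fun d : ℕ ↦ Real.exp (-(d : ℝ) ^ 2 / 4) := by
    have hg : Summable fun d : ℕ ↦ Real.exp (d * (-1 / 4)) :=
      Real.summable_exp_nat_mul_iff.2 (by norm_num)
    refine hg.of_nonneg_of_le (fun d ↦ (Real.exp_pos _).le) fun d ↦ Real.exp_le_exp.2 ?_
    have : (d : ℝ) ≤ (d : ℝ) ^ 2 := by exact_mod_cast Nat.le_self_pow two_ne_zero d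
    linarith
  apply Summable.of_nat_of_neg <;> simpa using h

/-- Schur's test for a symmetric kernel with bounded row sums. -/
theorem sum_sum_mul_le_of_symm {ι : Type*} (S : Finset ι) (K : ι → ι → ℝ) (D : ℝ)
    (hK : ∀ i j, 0 ≤ K i j) (hsymm : ∀ i j, K i j = K j i)
    (hD : ∀ i ∈ S, ∑ j ∈ S, K i j ≤ D) (x : ι → ℝ) :
    ∑ i ∈ S, ∑ j ∈ S, x i * x j * K i j ≤ D * ∑ i ∈ S, x i ^ 2 := by
  have h1 : ∑ i ∈ S, ∑ j ∈ S, x i ^ 2 * K i j ≤ D * ∑ i ∈ S, x i ^ 2 := by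
    rw [Finset.mul_sum]
    refine Finset.sum_le_sum fun i hi ↦ ?_
    rw [← Finset.mul_sum, mul_comm]
    exact mul_le_mul_of_nonneg_right (hD i hi) (sq_nonneg _)
  have h2 : ∑ i ∈ S, ∑ j ∈ S, x j ^ 2 * K i j = ∑ i ∈ S, ∑ j ∈ S, x i ^ 2 * K i j := by
    rw [Finset.sum_comm]
    exact Finset.sum_congr rfl fun i _ ↦ Finset.sum_congr rfl fun j _ ↦ by rw [hsymm i j]
  have h3 : ∑ i ∈ S, ∑ j ∈ S, x i * x j * K i j ≤
      ∑ i ∈ S, ∑ j ∈ S, (x i ^ 2 * K i j + x j ^ 2 * K i j) / 2 := by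
    refine Finset.sum_le_sum fun i _ ↦ Finset.sum_le_sum fun j _ ↦ ?_
    nlinarith [mul_nonneg (sq_nonneg (x i - x j)) (hK i j)]
  simp_rw [← Finset.sum_div, Finset.sum_add_distrib] at h3
  linarith

theorem integral_gaussian_mul_cexp {T : ℝ} (hT : 0 < T) (u : ℝ) :
    Integrable (fun t : ℝ ↦ cexp (-((1 / T ^ 2 : ℝ) : ℂ) * (t : ℂ) ^ 2 + (-(I * u)) * t + 0)) ∧
    ‖∫ t : ℝ, cexp (-((1 / T ^ 2 : ℝ) : ℂ) * (t : ℂ) ^ 2 + (-(I * u)) * t + 0)‖ =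
      T * √Real.pi * Real.exp (-(T ^ 2 * u ^ 2 / 4)) := by
  have hb : 0 < (((1 / T ^ 2 : ℝ) : ℂ)).re := by rw [ofReal_re]; positivity
  refine ⟨integrable_cexp_quadratic hb _ _, ?_⟩
  rw [integral_cexp_quadratic (by rw [neg_re]; linarith), norm_mul, neg_neg, ← ofReal_div,
    show ((1 / 2 : ℂ)) = ((1 / 2 : ℝ) : ℂ) by norm_num,
    ← ofReal_cpow (by positivity), norm_real, Complex.norm_exp, ← Real.sqrt_eq_rpow]
  have h1 : (0 - (-(I * (u : ℂ))) ^ 2 / (4 * -((1 / T ^ 2 : ℝ) : ℂ))) =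
      ((-(T ^ 2 * u ^ 2 / 4) : ℝ) : ℂ) := by
    have : (T : ℂ) ≠ 0 := by exact_mod_cast hT.ne'
    push_cast
    field_simp
    rw [I_sq]
    ring
  rw [h1, ofReal_re, div_div_eq_mul_div, div_one, Real.sqrt_mul Real.pi_pos.le,
    Real.sqrt_sq hT.le, Real.norm_of_nonneg (by positivity), mul_comm T]

/-- A mean value theorem for Dirichlet polynomials of length at most `T`. -/
theorem integral_norm_sq_dirichlet_polynomial_le :
    ∃ C > (0 : ℝ), ∀ T : ℝ, 0 < T → ∀ S : Finset ℕ, (∀ n ∈ S, 0 < n ∧ (n : ℝ) ≤ T) →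
      ∀ b : ℕ → ℂ,
      (∫ t in T..(2 * T), ‖∑ n ∈ S, b n * cexp (-(I * (Real.log n : ℝ)) * (t : ℂ))‖ ^ 2) ≤
        C * T * ∑ n ∈ S, ‖b n‖ ^ 2 := by
  set D : ℝ := ∑' d : ℤ, Real.exp (-(d : ℝ) ^ 2 / 4)
  have hDpos : 0 < D :=
    summable_exp_neg_int_sq_div_four.tsum_pos (fun _ ↦ (Real.exp_pos _).le) 0 (Real.exp_pos _)
  refine ⟨Real.exp 4 * (√Real.pi * D), by positivity, fun T hT S hS b ↦ ?_⟩
  set P : ℝ → ℂ := fun t ↦ ∑ n ∈ S, b n * cexp (-(I * (Real.log n : ℝ)) * (t : ℂ)) with hP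
  set w : ℝ → ℝ := fun t ↦ Real.exp (-(1 / T ^ 2) * t ^ 2) with hw
  set G : ℕ → ℕ → ℝ → ℂ := fun m n t ↦
    cexp (-((1 / T ^ 2 : ℝ) : ℂ) * (t : ℂ) ^ 2 +
      (-(I * ((Real.log m - Real.log n : ℝ) : ℂ))) * t + 0) with hG
  have hGint (m n : ℕ) : Integrable (G m n) := (integral_gaussian_mul_cexp hT _).1
  have hPcont : Continuous P := by fun_prop
  have hexp (t : ℝ) : ((w t * ‖P t‖ ^ 2 : ℝ) : ℂ) =
      ∑ m ∈ S, ∑ n ∈ S, b m * (starRingEnd ℂ) (b n) * G m n t := by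
    rw [ofReal_mul, ofReal_pow, ← Complex.mul_conj', hP]
    simp only [map_sum]
    rw [Finset.sum_mul_sum, Finset.mul_sum]
    simp only [Finset.mul_sum]
    refine Finset.sum_congr rfl fun m _ ↦ Finset.sum_congr rfl fun n _ ↦ ?_
    rw [map_mul, ← Complex.exp_conj, hw, hG]
    simp only [map_mul, map_neg, conj_I, conj_ofReal, ofReal_exp]
    rw [show ∀ x y z u v : ℂ, x * (y * z * (u * v)) = y * u * (x * z * v) by intros; ring,
      ← Complex.exp_add, ← Complex.exp_add]
    congr 2
    push_cast
    ring
  have hint : Integrable fun t ↦ ((w t * ‖P t‖ ^ 2 : ℝ) : ℂ) := by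
    simp_rw [hexp]
    exact integrable_finsetSum _ fun m _ ↦ integrable_finsetSum _ fun n _ ↦
      (hGint m n).const_mul _
  have hintR : Integrable fun t ↦ w t * ‖P t‖ ^ 2 := hint.re
  have hbound : ∫ t, w t * ‖P t‖ ^ 2 ≤ T * √Real.pi * (D * ∑ n ∈ S, ‖b n‖ ^ 2) := by
    have h0 : 0 ≤ ∫ t, w t * ‖P t‖ ^ 2 := integral_nonneg fun t ↦ by positivity
    rw [← Real.norm_of_nonneg h0, ← norm_real, ← integral_complex_ofReal]
    simp_rw [hexp]
    rw [integral_finsetSum _ fun m _ ↦ integrable_finsetSum _ fun n _ ↦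
      (hGint m n).const_mul _]
    simp_rw [integral_finsetSum S fun n _ ↦ (hGint _ n).const_mul _, integral_const_mul]
    calc _ ≤ ∑ m ∈ S, ∑ n ∈ S, T * √Real.pi *
          (‖b m‖ * ‖b n‖ * Real.exp (-(((m : ℤ) - n : ℤ) : ℝ) ^ 2 / 4)) := by
          refine (norm_sum_le _ _).trans (Finset.sum_le_sum fun m hm ↦
            (norm_sum_le _ _).trans (Finset.sum_le_sum fun n hn ↦ ?_))
          rw [norm_mul, norm_mul, RCLike.norm_conj, (integral_gaussian_mul_cexp hT _).2]
          have := gaussian_log_sub_le (hS m hm).1 (hS n hn).1 (hS m hm).2 (hS n hn).2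
          calc _ = T * √Real.pi * (‖b m‖ * ‖b n‖ *
                Real.exp (-(T ^ 2 * (Real.log m - Real.log n) ^ 2 / 4))) := by ring
            _ ≤ _ := by gcongr
      _ ≤ _ := by
          simp_rw [← Finset.mul_sum]
          refine mul_le_mul_of_nonneg_left ?_ (by positivity)
          refine sum_sum_mul_le_of_symm S
            (fun m n : ℕ ↦ Real.exp (-(((m : ℤ) - n : ℤ) : ℝ) ^ 2 / 4)) D
            (fun _ _ ↦ (Real.exp_pos _).le) (fun m n ↦ ?_) (fun m _ ↦ ?_) fun n ↦ ‖b n‖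
          · push_cast
            rw [sub_sq_comm]
          · have hinj : Function.Injective fun n : ℕ ↦ (m : ℤ) - n := fun x y h ↦ by
              simpa using h
            rw [← Finset.sum_image (s := S) (g := fun n : ℕ ↦ (m : ℤ) - n)
              (f := fun d : ℤ ↦ Real.exp (-(d : ℝ) ^ 2 / 4)) hinj.injOn]
            exact summable_exp_neg_int_sq_div_four.sum_le_tsum _ fun _ _ ↦ (Real.exp_pos _).le
  calc ∫ t in T..(2 * T), ‖P t‖ ^ 2
      ≤ ∫ t in T..(2 * T), Real.exp 4 * (w t * ‖P t‖ ^ 2) := by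
        refine intervalIntegral.integral_mono_on (by linarith)
          (Continuous.intervalIntegrable (by fun_prop) _ _)
          (Continuous.intervalIntegrable (by fun_prop) _ _) fun t ht ↦ ?_
        rw [← mul_assoc, hw, ← Real.exp_add]
        refine le_mul_of_one_le_left (by positivity) (Real.one_le_exp ?_)
        have h4 : t ^ 2 ≤ 4 * T ^ 2 := by nlinarith [ht.1, ht.2]
        have h5 : 1 / T ^ 2 * t ^ 2 ≤ 4 := by
          rw [one_div_mul_eq_div, div_le_iff₀ (by positivity)]
          exact h4
        linarith
    _ = Real.exp 4 * ∫ t in T..(2 * T), w t * ‖P t‖ ^ 2 := intervalIntegral.integral_const_mul _ _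
    _ ≤ Real.exp 4 * ∫ t, w t * ‖P t‖ ^ 2 := by
        rw [intervalIntegral.integral_of_le (by linarith)]
        refine mul_le_mul_of_nonneg_left (setIntegral_le_integral hintR ?_) (Real.exp_pos _).le
        exact Filter.Eventually.of_forall fun t ↦ by positivity
    _ ≤ Real.exp 4 * (T * √Real.pi * (D * ∑ n ∈ S, ‖b n‖ ^ 2)) := by gcongr
    _ = _ := by ring

/-- An integer has at most `k!` ordered factorizations into `k` primes. -/
theorem card_filter_prod_eq_le_factorial {k : ℕ} (F : Finset (Fin k → ℕ))
    (hF : ∀ f ∈ F, ∀ i, (f i).Prime) (n : ℕ) :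
    (F.filter fun f ↦ ∏ i, f i = n).card ≤ k.factorial := by
  have hperm : ∀ f ∈ F.filter (fun f ↦ ∏ i, f i = n),
      (List.ofFn f).Perm n.primeFactorsList := fun f hf ↦ by
    rw [Finset.mem_filter] at hf
    refine Nat.primeFactorsList_unique (by rw [List.prod_ofFn, hf.2]) fun p hp ↦ ?_
    obtain ⟨i, rfl⟩ := (List.mem_ofFn' f p).1 hp
    exact hF f hf.1 i
  rcases (F.filter fun f ↦ ∏ i, f i = n).eq_empty_or_nonempty with h | ⟨g, hg⟩
  · simp [h]
  · have hlen : n.primeFactorsList.length = k := by simpa using (hperm g hg).length_eq.symm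
    calc _ ≤ n.primeFactorsList.permutations.toFinset.card :=
          Finset.card_le_card_of_injOn List.ofFn
            (fun f hf ↦ by simpa using hperm f hf) List.ofFn_injective.injOn
      _ ≤ n.primeFactorsList.permutations.length := List.toFinset_card_le _
      _ = _ := by rw [List.length_permutations, hlen]

/-- Cauchy–Schwarz on the fibres of a map whose fibres have at most `M` elements. -/
theorem sum_norm_sq_fiber_sum_le {ι κ : Type*} [DecidableEq κ] (F : Finset ι) (g : ι → κ)
    (S : Finset κ) (hS : ∀ i ∈ F, g i ∈ S) (M : ℕ)
    (hM : ∀ n, (F.filter fun i ↦ g i = n).card ≤ M) (A : ι → ℂ) :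
    ∑ n ∈ S, ‖∑ i ∈ F with g i = n, A i‖ ^ 2 ≤ M * ∑ i ∈ F, ‖A i‖ ^ 2 := by
  rw [← Finset.sum_fiberwise_of_maps_to hS fun i ↦ ‖A i‖ ^ 2, Finset.mul_sum]
  refine Finset.sum_le_sum fun n _ ↦ ?_
  calc ‖∑ i ∈ F with g i = n, A i‖ ^ 2 ≤ (∑ i ∈ F with g i = n, ‖A i‖) ^ 2 := by
        gcongr
        exact norm_sum_le _ _
    _ ≤ (F.filter fun i ↦ g i = n).card * ∑ i ∈ F with g i = n, ‖A i‖ ^ 2 :=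
        sq_sum_le_card_mul_sum_sq
    _ ≤ _ := by
        gcongr
        exact hM n

theorem sum_pow_eq_sum_piFinset_const {ι R : Type*} [CommSemiring R] (s : Finset ι) (g : ι → R)
    (k : ℕ) : (∑ i ∈ s, g i) ^ k = ∑ f ∈ Fintype.piFinset fun _ : Fin k ↦ s, ∏ j, g (f j) := by
  simpa using Finset.prod_univ_sum (fun _ : Fin k ↦ s) fun _ i ↦ g i

/-- The `k`-th power of a Dirichlet polynomial over primes, grouped by the product of the primes. -/
theorem dirichlet_polynomial_pow_eq (Q : Finset ℕ) (hQ : ∀ p ∈ Q, p.Prime) (k : ℕ) (a : ℕ → ℂ)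
    (S : Finset ℕ) (hS : ∀ f ∈ Fintype.piFinset fun _ : Fin k ↦ Q, ∏ i, f i ∈ S) (t : ℝ) :
    (∑ p ∈ Q, a p * (p : ℂ) ^ (-(I * (t : ℂ)))) ^ k =
      ∑ n ∈ S, (∑ f ∈ Fintype.piFinset fun _ : Fin k ↦ Q with ∏ i, f i = n, ∏ i, a (f i)) *
        cexp (-(I * (Real.log n : ℝ)) * (t : ℂ)) := by
  have hterm : ∀ f ∈ Fintype.piFinset fun _ : Fin k ↦ Q,
      ∏ i, (a (f i) * (f i : ℂ) ^ (-(I * (t : ℂ)))) =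
        (∏ i, a (f i)) * cexp (-(I * (Real.log (∏ i, f i : ℕ) : ℝ)) * (t : ℂ)) := fun f hf ↦ by
    have hne (i : Fin k) : f i ≠ 0 := (hQ _ (Fintype.mem_piFinset.1 hf i)).ne_zero
    rw [Finset.prod_mul_distrib, Nat.cast_prod,
      Real.log_prod fun i _ ↦ Nat.cast_ne_zero.2 (hne i), ofReal_sum,
      Finset.mul_sum, ← Finset.sum_neg_distrib, Finset.sum_mul, Complex.exp_sum]
    congr 1
    refine Finset.prod_congr rfl fun i _ ↦ ?_
    rw [Complex.cpow_def_of_ne_zero (Nat.cast_ne_zero.2 (hne i)), ← Complex.natCast_log]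
    congr 1
    ring
  rw [sum_pow_eq_sum_piFinset_const, Finset.sum_congr rfl hterm,
    ← Finset.sum_fiberwise_of_maps_to hS]
  refine Finset.sum_congr rfl fun n _ ↦ ?_
  rw [Finset.sum_mul]
  exact Finset.sum_congr rfl fun f hf ↦ by rw [(Finset.mem_filter.1 hf).2]

/-- **Lemma (moments of Dirichlet polynomials).** For `T ≥ 5`, `X ≥ 3`, `k ≥ 1` with
`X^k ≤ T`, and any complex `a(p)`:
`∫_T^{2T} |∑_{p≤X} a(p) p^{-it}|^{2k} dt ≪ T k! (∑_{p≤X} |a(p)|²)^k`,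
with an absolute implied constant. -/
theorem dirichlet_polynomial_moment_bound :
    ∃ C > (0:ℝ), ∀ T X : ℝ, ∀ k : ℕ, 5 ≤ T → 3 ≤ X → 0 < k → X ^ (k:ℝ) ≤ T →
      ∀ a : ℕ → ℂ,
      (∫ t in T..(2*T),
          ‖∑ p ∈ primesUpTo X, a p * (p:ℂ) ^ (-(Complex.I * (t:ℂ)))‖^(2*k)) ≤
        C * T * (k.factorial) * (∑ p ∈ primesUpTo X, ‖a p‖^2)^k := by
  obtain ⟨C, hC, hmv⟩ := integral_norm_sq_dirichlet_polynomial_le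
  refine ⟨C, hC, fun T X k hT hX _ hXT a ↦ ?_⟩
  set F : Finset (Fin k → ℕ) := Fintype.piFinset fun _ ↦ primesUpTo X
  have hprime : ∀ f ∈ F, ∀ i, (f i).Prime := fun f hf i ↦
    (Finset.mem_filter.1 (Fintype.mem_piFinset.1 hf i)).2
  have hleX : ∀ f ∈ F, ∀ i, (f i : ℝ) ≤ X := fun f hf i ↦ by
    have h := Finset.mem_range.1 (Finset.mem_filter.1 (Fintype.mem_piFinset.1 hf i)).1
    exact (Nat.le_floor_iff (by linarith)).1 (Nat.lt_succ_iff.1 h)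
  set S : Finset ℕ := F.image fun f ↦ ∏ i, f i
  have hmaps : ∀ f ∈ F, ∏ i, f i ∈ S := fun f hf ↦ Finset.mem_image_of_mem _ hf
  have hS : ∀ n ∈ S, 0 < n ∧ (n : ℝ) ≤ T := fun n hn ↦ by
    obtain ⟨f, hf, rfl⟩ := Finset.mem_image.1 hn
    refine ⟨Finset.prod_pos fun i _ ↦ (hprime f hf i).pos, le_trans ?_ hXT⟩
    rw [Real.rpow_natCast, Nat.cast_prod]
    simpa using Finset.prod_le_prod (s := Finset.univ) (fun i _ ↦ Nat.cast_nonneg (f i))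
      fun i _ ↦ hleX f hf i
  set A : (Fin k → ℕ) → ℂ := fun f ↦ ∏ i, a (f i) with hA
  have hpow := dirichlet_polynomial_pow_eq (primesUpTo X)
    (fun p hp ↦ (Finset.mem_filter.1 hp).2) k a S hmaps
  have hnorm : ∑ f ∈ F, ‖A f‖ ^ 2 = (∑ p ∈ primesUpTo X, ‖a p‖ ^ 2) ^ k := by
    rw [sum_pow_eq_sum_piFinset_const]
    exact Finset.sum_congr rfl fun f _ ↦ by rw [hA, norm_prod, Finset.prod_pow]
  have hnormpow (z : ℂ) : ‖z‖ ^ (2 * k) = ‖z ^ k‖ ^ 2 := by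
    rw [norm_pow, ← pow_mul, mul_comm]
  have hfib : ∑ n ∈ S, ‖∑ f ∈ F with ∏ i, f i = n, A f‖ ^ 2 ≤
      k.factorial * ∑ f ∈ F, ‖A f‖ ^ 2 :=
    sum_norm_sq_fiber_sum_le F (fun f ↦ ∏ i, f i) S hmaps _
      (card_filter_prod_eq_le_factorial F hprime) A
  have hmean := hmv T (by linarith) S hS fun n ↦ ∑ f ∈ F with ∏ i, f i = n, A f
  simp_rw [hnormpow, hpow]
  refine hmean.trans ?_
  rw [mul_assoc (C * T), ← hnorm]
  exact mul_le_mul_of_nonneg_left hfib (mul_pos hC (by linarith)).le
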